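/- arXiv:math/9708204 — 7 statements merged into one kernel-verified Lean document; each statement's English description precedes it below -/
import Mathlib

section
/- (F. and M. Riesz theorem on ℝ.) Let μ be a complex Borel measure on ℝ, represented by a pair (ρ, f). If the Fourier–Stieltjes transform μ̂(s) = ∫_ℝ e^{−2πi s x} f(x) dρ(x) vanishes for every s < 0, then μ is absolutely continuous with respect to Lebesgue measure: for every Borel set A ⊆ ℝ of Lebesgue measure zero, ∫_A f dρ = 0. -/
open MeasureTheory

open Filter Topology in
/-- If the Fourier–Stieltjes transform of `f ρ` vanishes on a half line, then so does that of
`f ρ / (x - c + i ε)`. -/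
lemma integral_exp_mul_div_eq_zero {ρ : Measure ℝ} [SFinite ρ] {f : ℝ → ℂ} (hf : Integrable f ρ)
    (hF : ∀ t : ℝ, 0 < t → ∫ x, Complex.exp ((t * x : ℝ) * Complex.I) * f x ∂ρ = 0)
    (c : ℝ) {ε : ℝ} (hε : 0 < ε) (t : ℝ) (ht : 0 < t) :
    ∫ x, Complex.exp ((t * x : ℝ) * Complex.I) * (f x / ((x - c : ℝ) + ε * Complex.I)) ∂ρ = 0 := by
  set a : ℝ → ℂ := fun x => -ε + (x - c : ℝ) * Complex.I with ha
  have hare : ∀ x, (a x).re = -ε := fun x => by simp [ha]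
  have ha0 : ∀ x, a x ≠ 0 := fun x h => by
    have := hare x
    rw [h] at this
    simp at this
    exact hε.ne' this
  have hinner : ∀ x, Complex.exp ((t * x : ℝ) * Complex.I) * (f x / ((x - c : ℝ) + ε * Complex.I))
      = -Complex.I * ∫ u in Set.Ioi (0 : ℝ),
          Complex.exp ((t * x : ℝ) * Complex.I) * f x * Complex.exp (a x * u) := fun x => by
    rw [integral_const_mul, integral_exp_mul_complex_Ioi (by rw [hare]; linarith)]
    have h1 : ((x - c : ℝ) + ε * Complex.I : ℂ) = -Complex.I * a x := by
      simp only [ha]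
      linear_combination ((x - c : ℝ) : ℂ) * Complex.I_sq
    have h2 := ha0 x
    rw [h1]
    simp only [Complex.ofReal_zero, mul_zero, Complex.exp_zero]
    field_simp
    rw [Complex.I_sq]
    ring
  simp_rw [hinner]
  rw [integral_const_mul, integral_integral_swap]
  · have : ∀ u ∈ Set.Ioi (0 : ℝ),
        ∫ x, Complex.exp ((t * x : ℝ) * Complex.I) * f x * Complex.exp (a x * u) ∂ρ = 0 := by
      intro u hu
      have h := hF (t + u) (add_pos ht hu)
      have h1 : ∀ x, Complex.exp ((t * x : ℝ) * Complex.I) * f x * Complex.exp (a x * u) =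
          Complex.exp ((-ε - c * Complex.I) * u) *
            (Complex.exp (((t + u) * x : ℝ) * Complex.I) * f x) := fun x => by
        rw [mul_right_comm, ← Complex.exp_add, ← mul_assoc, ← Complex.exp_add]
        congr 2
        simp only [ha]
        push_cast
        ring
      simp_rw [h1]
      rw [integral_const_mul, h, mul_zero]
    rw [setIntegral_congr_fun measurableSet_Ioi this]
    simp
  · have hb : Integrable (fun p : ℝ × ℝ => f p.1 * (Real.exp (-ε * p.2) : ℂ))
        (ρ.prod (volume.restrict (Set.Ioi 0))) :=
      hf.mul_prod (integrableOn_exp_mul_Ioi (by linarith) 0).ofReal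
    refine hb.mono ?_ (Eventually.of_forall fun p => ?_)
    · refine AEStronglyMeasurable.mul (AEStronglyMeasurable.mul ?_ hf.1.comp_fst) ?_
      · exact Continuous.aestronglyMeasurable (by fun_prop)
      · exact Continuous.aestronglyMeasurable (by fun_prop)
    · simp only [Function.uncurry, norm_mul, Complex.norm_exp_ofReal_mul_I, one_mul,
        Complex.norm_real, Real.norm_eq_abs, Real.abs_exp]
      rw [Complex.norm_exp, Complex.re_mul_ofReal, hare]

lemma norm_div_add_mul_I_le_one (y ε : ℝ) : ‖(y : ℂ) / (y + ε * Complex.I)‖ ≤ 1 := by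
  rw [norm_div]
  refine div_le_one_of_le₀ ?_ (norm_nonneg _)
  simpa using Complex.abs_re_le_norm (y + ε * Complex.I)

lemma continuous_prod_div_add_mul_I (S : Finset ℝ) {ε : ℝ} (hε : 0 < ε) :
    Continuous fun x : ℝ => ∏ c ∈ S, ((x - c : ℝ) : ℂ) / ((x - c : ℝ) + ε * Complex.I) := by
  refine continuous_finsetProd _ fun c _ => Continuous.div (by fun_prop) (by fun_prop) fun x h => ?_
  have := congrArg Complex.im h
  simp at this
  exact hε.ne' this

lemma norm_prod_div_add_mul_I_le_one (S : Finset ℝ) (ε x : ℝ) :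
    ‖∏ c ∈ S, ((x - c : ℝ) : ℂ) / ((x - c : ℝ) + ε * Complex.I)‖ ≤ 1 := by
  rw [norm_prod]
  exact Finset.prod_le_one (fun _ _ => norm_nonneg _) fun c _ => norm_div_add_mul_I_le_one _ _

lemma integrable_prod_div_mul {ρ : Measure ℝ} {f : ℝ → ℂ} (hf : Integrable f ρ) (S : Finset ℝ)
    {ε : ℝ} (hε : 0 < ε) :
    Integrable (fun x : ℝ =>
      (∏ c ∈ S, ((x - c : ℝ) : ℂ) / ((x - c : ℝ) + ε * Complex.I)) * f x) ρ :=
  hf.bdd_mul (continuous_prod_div_add_mul_I S hε).aestronglyMeasurable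
    (Filter.Eventually.of_forall (norm_prod_div_add_mul_I_le_one S ε))

lemma integrable_exp_mul {ρ : Measure ℝ} {f : ℝ → ℂ} (hf : Integrable f ρ) (t : ℝ) :
    Integrable (fun x : ℝ => Complex.exp ((t * x : ℝ) * Complex.I) * f x) ρ :=
  hf.bdd_mul (c := 1) (Continuous.aestronglyMeasurable (by fun_prop))
    (Filter.Eventually.of_forall fun x => (Complex.norm_exp_ofReal_mul_I _).le)

lemma integral_exp_mul_prod_eq_zero {ρ : Measure ℝ} [SFinite ρ] {f : ℝ → ℂ} (hf : Integrable f ρ)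
    (hF : ∀ t : ℝ, 0 < t → ∫ x, Complex.exp ((t * x : ℝ) * Complex.I) * f x ∂ρ = 0)
    (S : Finset ℝ) {ε : ℝ} (hε : 0 < ε) (t : ℝ) (ht : 0 < t) :
    ∫ x, Complex.exp ((t * x : ℝ) * Complex.I) *
      ((∏ c ∈ S, ((x - c : ℝ) : ℂ) / ((x - c : ℝ) + ε * Complex.I)) * f x) ∂ρ = 0 := by
  induction S using Finset.induction_on generalizing t with
  | empty => simpa using hF t ht
  | insert c S hc ih =>
    have hg := integrable_prod_div_mul hf S hε
    have hgc := integrable_prod_div_mul hf (insert c S) hε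
    set g : ℝ → ℂ := fun x =>
      (∏ c ∈ S, ((x - c : ℝ) : ℂ) / ((x - c : ℝ) + ε * Complex.I)) * f x with hgdef
    have hne : ∀ x : ℝ, ((x - c : ℝ) + ε * Complex.I : ℂ) ≠ 0 := fun x h => by
      have := congrArg Complex.im h
      simp at this
      exact hε.ne' this
    have key : ∀ x : ℝ, (ε * Complex.I) * (Complex.exp ((t * x : ℝ) * Complex.I) *
          (g x / ((x - c : ℝ) + ε * Complex.I))) =
        Complex.exp ((t * x : ℝ) * Complex.I) * g x - Complex.exp ((t * x : ℝ) * Complex.I) *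
      ((∏ c ∈ insert c S, ((x - c : ℝ) : ℂ) / ((x - c : ℝ) + ε * Complex.I)) * f x) := fun x => by
      rw [Finset.prod_insert hc, hgdef]
      have := hne x
      field_simp
      ring
    have h := integral_exp_mul_div_eq_zero hg ih c hε t ht
    have h2 := congrArg (fun z => (ε * Complex.I) * z) h
    simp only [mul_zero] at h2
    rw [← integral_const_mul] at h2
    simp_rw [key] at h2
    rw [integral_sub (integrable_exp_mul hg t) (integrable_exp_mul hgc t), ih t ht, zero_sub,
      neg_eq_zero] at h2
    exact h2

open Filter Topology in
/-- A compact null set has covers by finitely many intervals of a common length and of small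
total length. -/
lemma exists_finset_cover_of_volume_eq_zero {K : Set ℝ} (hK : IsCompact K) (h0 : volume K = 0)
    {η : ℝ} (hη : 0 < η) :
    ∃ r > 0, r ≤ η ∧ ∃ S : Finset ℝ, S.card * r ≤ η ∧ (∀ x ∈ K, ∃ c ∈ S, |x - c| ≤ r) ∧
      ∀ c ∈ S, ∃ y ∈ K, |y - c| ≤ r := by
  have ht : Tendsto (fun r => volume (Metric.cthickening r K)) (𝓝 0) (𝓝 (volume K)) :=
    tendsto_measure_cthickening_of_isCompact hK
  rw [h0] at ht
  have hev : ∀ᶠ r in 𝓝[>] (0 : ℝ), volume (Metric.cthickening r K) < ENNReal.ofReal η :=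
    (ht.mono_left nhdsWithin_le_nhds).eventually_lt_const (by simpa using hη)
  obtain ⟨r, hr, hr0, hrη⟩ := (hev.and (Ioc_mem_nhdsGT hη)).exists
  have hr0 : 0 < r := hr0
  have hfl : ∀ x : ℝ, (⌊x / r⌋ : ℝ) * r ≤ x ∧ x < ((⌊x / r⌋ : ℝ) + 1) * r := fun x =>
    ⟨by rw [← le_div_iff₀ hr0]; exact Int.floor_le _,
      by rw [← div_lt_iff₀ hr0]; exact Int.lt_floor_add_one _⟩
  have hfin : ((fun x : ℝ => ⌊x / r⌋) '' K).Finite := by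
    obtain ⟨a, ha⟩ := hK.bddBelow
    obtain ⟨b, hb⟩ := hK.bddAbove
    refine (Set.finite_Icc ⌊a / r⌋ ⌊b / r⌋).subset ?_
    rintro _ ⟨x, hx, rfl⟩
    have h1 := ha hx
    have h2 := hb hx
    exact ⟨Int.floor_le_floor (by gcongr), Int.floor_le_floor (by gcongr)⟩
  set T : Finset ℤ := hfin.toFinset with hT
  have hmem : ∀ m, m ∈ T ↔ ∃ x ∈ K, ⌊x / r⌋ = m := fun m => by simp [hT]
  refine ⟨r, hr0, hrη, T.image fun m : ℤ => (m : ℝ) * r, ?_, ?_, ?_⟩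
  · have hsub : (⋃ m ∈ T, Set.Ico ((m : ℝ) * r) (((m : ℝ) + 1) * r)) ⊆
        Metric.cthickening r K := by
      intro y hy
      simp only [Set.mem_iUnion] at hy
      obtain ⟨m, hm, hy1, hy2⟩ := hy
      obtain ⟨x, hx, rfl⟩ := (hmem m).1 hm
      have := hfl x
      refine Metric.mem_cthickening_of_dist_le y x r K hx ?_
      rw [Real.dist_eq, abs_le]
      constructor <;> linarith
    have hvol : volume (⋃ m ∈ T, Set.Ico ((m : ℝ) * r) (((m : ℝ) + 1) * r)) =
        ENNReal.ofReal (T.card * r) := by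
      rw [measure_biUnion_finset _ fun _ _ => measurableSet_Ico]
      · have : ∀ m : ℤ, ((m : ℝ) + 1) * r - m * r = r := fun m => by ring
        simp_rw [Real.volume_Ico, this]
        rw [Finset.sum_const, nsmul_eq_mul, ENNReal.ofReal_mul (by positivity)]
        simp
      · intro m _ n _ hmn
        rw [Function.onFun, Set.disjoint_left]
        rintro y ⟨h1, h2⟩ ⟨h3, h4⟩
        have h5 : (m : ℝ) < n + 1 := lt_of_mul_lt_mul_right (h1.trans_lt h4) hr0.le
        have h6 : (n : ℝ) < m + 1 := lt_of_mul_lt_mul_right (h3.trans_lt h2) hr0.le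
        norm_cast at h5 h6
        omega
    have h := (hvol.symm.trans_le (measure_mono hsub)).trans hr.le
    rw [ENNReal.ofReal_le_ofReal_iff hη.le] at h
    refine le_trans ?_ h
    gcongr
    exact Finset.card_image_le
  · intro x hx
    refine ⟨_, Finset.mem_image_of_mem _ ((hmem _).2 ⟨x, hx, rfl⟩), ?_⟩
    have := hfl x
    rw [abs_le]
    constructor <;> linarith
  · intro c hc
    obtain ⟨m, hm, rfl⟩ := Finset.mem_image.1 hc
    obtain ⟨x, hx, rfl⟩ := (hmem m).1 hm
    refine ⟨x, hx, ?_⟩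
    have := hfl x
    rw [abs_le]
    constructor <;> linarith

open Filter Topology in
/-- Products of the quotients `(x - c) / (x - c + i ε)` converge boundedly to the indicator of the
complement of a compact null set. -/
lemma exists_prod_tendsto_indicator_compl {K : Set ℝ} (hK : IsCompact K) (h0 : volume K = 0) :
    ∃ (S : ℕ → Finset ℝ) (ε : ℕ → ℝ), (∀ n, 0 < ε n) ∧ ∀ x : ℝ,
      Tendsto (fun n => ∏ c ∈ S n, ((x - c : ℝ) : ℂ) / ((x - c : ℝ) + ε n * Complex.I)) atTop
        (𝓝 (Kᶜ.indicator 1 x)) := by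
  have hpos : ∀ n : ℕ, (0 : ℝ) < 1 / ((n : ℝ) + 1) := fun n => by positivity
  choose r hr0 hrη S hcard hcov hnear using fun n : ℕ =>
    exists_finset_cover_of_volume_eq_zero hK h0 (pow_pos (hpos n) 2)
  have hlim : Tendsto (fun n : ℕ => 1 / ((n : ℝ) + 1)) atTop (𝓝 0) :=
    tendsto_one_div_add_atTop_nhds_zero_nat
  have hεpos : ∀ n : ℕ, 0 < ((n : ℝ) + 1) * r n := fun n => by have := hr0 n; positivity
  refine ⟨S, fun n => ((n : ℝ) + 1) * r n, hεpos, fun x => ?_⟩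
  by_cases hx : x ∈ K
  · rw [Set.indicator_of_notMem (by simpa using hx)]
    refine squeeze_zero_norm (fun n => ?_) hlim
    obtain ⟨c, hc, hxc⟩ := hcov n x hx
    rw [norm_prod, ← Finset.mul_prod_erase _ _ hc]
    refine (mul_le_of_le_one_right (norm_nonneg _) (Finset.prod_le_one (fun _ _ => norm_nonneg _)
      fun c _ => norm_div_add_mul_I_le_one _ _)).trans ?_
    have him := Complex.abs_im_le_norm (((x - c : ℝ) : ℂ) + (((n : ℝ) + 1) * r n : ℝ) * Complex.I)
    have : (((x - c : ℝ) : ℂ) + (((n : ℝ) + 1) * r n : ℝ) * Complex.I).im = ((n : ℝ) + 1) * r n := by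
      simp
    rw [this, abs_of_pos (hεpos n)] at him
    rw [norm_div, Complex.norm_real, Real.norm_eq_abs]
    calc _ ≤ r n / (((n : ℝ) + 1) * r n) :=
          div_le_div₀ (hr0 n).le hxc (hεpos n) him
      _ = 1 / ((n : ℝ) + 1) := by
          have := (hr0 n).ne'
          field_simp
  · rw [Set.indicator_of_mem (by simpa using hx), Pi.one_apply]
    obtain ⟨d, hd, hball⟩ := Metric.isOpen_iff.1 hK.isClosed.isOpen_compl x hx
    have hev : ∀ᶠ n : ℕ in atTop, 1 / ((n : ℝ) + 1) < min 1 (d / 2) :=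
      hlim.eventually_lt_const (by positivity)
    rw [tendsto_iff_norm_sub_tendsto_zero]
    have hexp : Tendsto (fun n : ℕ => Real.exp (2 / d * (1 / ((n : ℝ) + 1))) - 1) atTop (𝓝 0) := by
      have := ((Real.continuous_exp.tendsto _).comp (hlim.const_mul (2 / d))).sub_const 1
      simpa [Function.comp_def] using this
    refine squeeze_zero' (Eventually.of_forall fun _ => norm_nonneg _) ?_ hexp
    filter_upwards [hev] with n hn
    have hn1 := (lt_min_iff.1 hn).1
    have hn2 := (lt_min_iff.1 hn).2
    have hfar : ∀ c ∈ S n, d / 2 ≤ |x - c| := fun c hc => by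
      obtain ⟨y, hy, hyc⟩ := hnear n c hc
      have h1 : d ≤ |y - x| := by
        by_contra! h
        exact hball (by simpa [Real.dist_eq] using h) hy
      have h2 : r n ≤ 1 / ((n : ℝ) + 1) :=
        (hrη n).trans (pow_le_of_le_one (hpos n).le hn1.le two_ne_zero)
      have h3 := abs_sub_le y c x
      rw [abs_sub_comm c x] at h3
      linarith
    set e : ℝ := ((n : ℝ) + 1) * r n with he
    have he0 : 0 < e := hεpos n
    have hfac : ∀ c ∈ S n, ((x - c : ℝ) : ℂ) / ((x - c : ℝ) + e * Complex.I) =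
        1 + -(e * Complex.I) / ((x - c : ℝ) + e * Complex.I) := fun c _ => by
      have hne : ((x - c : ℝ) + e * Complex.I : ℂ) ≠ 0 := fun h => by
        have := congrArg Complex.im h
        simp at this
        exact he0.ne' this
      field_simp
      ring
    rw [Finset.prod_congr rfl hfac]
    refine (Finset.norm_prod_one_add_sub_one_le _ _).trans ?_
    gcongr
    calc _ ≤ ∑ c ∈ S n, e / (d / 2) := by
          refine Finset.sum_le_sum fun c hc => ?_
          have hre := Complex.abs_re_le_norm (((x - c : ℝ) : ℂ) + e * Complex.I)
          have : (((x - c : ℝ) : ℂ) + e * Complex.I).re = x - c := by simp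
          rw [this] at hre
          rw [norm_div]
          refine div_le_div₀ he0.le ?_ (by positivity) ((hfar c hc).trans hre)
          simp [abs_of_pos he0]
      _ = 2 / d * (((n : ℝ) + 1) * ((S n).card * r n)) := by
          rw [Finset.sum_const, nsmul_eq_mul, he]
          field_simp
      _ ≤ 2 / d * (((n : ℝ) + 1) * (1 / ((n : ℝ) + 1)) ^ 2) := by
          gcongr
          have := hcard n
          rwa [one_div_pow] at this ⊢
      _ = 2 / d * (1 / ((n : ℝ) + 1)) := by
          field_simp

open Filter Topology in
lemma setIntegral_eq_zero_of_isCompact {ρ : Measure ℝ} [SFinite ρ] {f : ℝ → ℂ}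
    (hf : Integrable f ρ)
    (hF : ∀ t : ℝ, 0 < t → ∫ x, Complex.exp ((t * x : ℝ) * Complex.I) * f x ∂ρ = 0)
    {K : Set ℝ} (hK : IsCompact K) (h0 : volume K = 0) : ∫ x in K, f x ∂ρ = 0 := by
  obtain ⟨S, ε, hε, hlim⟩ := exists_prod_tendsto_indicator_compl hK h0
  have hcompl : ∀ t : ℝ, 0 < t →
      ∫ x in Kᶜ, Complex.exp ((t * x : ℝ) * Complex.I) * f x ∂ρ = 0 := by
    intro t ht
    rw [← integral_indicator hK.measurableSet.compl]
    refine tendsto_nhds_unique (f := fun n : ℕ => ∫ x, Complex.exp ((t * x : ℝ) * Complex.I) *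
      ((∏ c ∈ S n, ((x - c : ℝ) : ℂ) / ((x - c : ℝ) + ε n * Complex.I)) * f x) ∂ρ)
      (l := atTop) ?_ ?_
    · refine tendsto_integral_of_dominated_convergence (fun x => ‖f x‖) (fun n => ?_) hf.norm
        (fun n => Eventually.of_forall fun x => ?_) (Eventually.of_forall fun x => ?_)
      · exact (integrable_exp_mul (integrable_prod_div_mul hf (S n) (hε n)) t).1
      · rw [norm_mul, Complex.norm_exp_ofReal_mul_I, one_mul, norm_mul]
        exact mul_le_of_le_one_left (norm_nonneg _) (norm_prod_div_add_mul_I_le_one _ _ _)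
      · have := ((hlim x).mul_const (f x)).const_mul (Complex.exp ((t * x : ℝ) * Complex.I))
        convert this using 2
        by_cases hx : x ∈ K <;> simp [hx]
    · simp_rw [fun n => integral_exp_mul_prod_eq_zero hf hF (S n) (hε n) t ht]
      exact tendsto_const_nhds
  have hzero : ∀ t : ℝ, 0 < t →
      ∫ x in K, Complex.exp ((t * x : ℝ) * Complex.I) * f x ∂ρ = 0 := by
    intro t ht
    have := integral_add_compl hK.measurableSet (integrable_exp_mul hf t)
    rwa [hcompl t ht, hF t ht, add_zero] at this
  refine tendsto_nhds_unique (f := fun n : ℕ =>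
      ∫ x in K, Complex.exp (((1 / ((n : ℝ) + 1)) * x : ℝ) * Complex.I) * f x ∂ρ)
      (l := atTop) ?_ ?_
  · refine tendsto_integral_of_dominated_convergence (fun x => ‖f x‖)
      (fun n => (integrable_exp_mul hf _).1.restrict) hf.norm.restrict
      (fun n => Eventually.of_forall fun x => ?_) (Eventually.of_forall fun x => ?_)
    · rw [norm_mul, Complex.norm_exp_ofReal_mul_I, one_mul]
    · have hc : Continuous fun t : ℝ => Complex.exp ((t * x : ℝ) * Complex.I) * f x := by fun_prop
      simpa [Function.comp_def] using
        (hc.tendsto 0).comp tendsto_one_div_add_atTop_nhds_zero_nat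
  · simp_rw [fun n : ℕ => hzero (1 / ((n : ℝ) + 1)) (by positivity)]
    exact tendsto_const_nhds

theorem stmt6 (ρ : Measure ℝ) [IsFiniteMeasure ρ] (f : ℝ → ℂ) (hf : Integrable f ρ)
    (hFS : ∀ s : ℝ, s < 0 →
      ∫ x, Complex.exp (((-(2 * Real.pi * s * x) : ℝ) : ℂ) * Complex.I) * f x ∂ρ = 0) :
    ∀ A : Set ℝ, MeasurableSet A → volume A = 0 → ∫ x in A, f x ∂ρ = 0 := by
  intro A hA h0
  have hF : ∀ t : ℝ, 0 < t → ∫ x, Complex.exp ((t * x : ℝ) * Complex.I) * f x ∂ρ = 0 := by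
    intro t ht
    have h := hFS (-(t / (2 * Real.pi))) (neg_lt_zero.2 (by positivity))
    have : ∀ x : ℝ, -(2 * Real.pi * -(t / (2 * Real.pi)) * x) = t * x := fun x => by
      field_simp
    simpa only [this] using h
  have hpos : ∀ n : ℕ, ((n : ENNReal) + 1)⁻¹ ≠ 0 := fun n =>
    ENNReal.inv_ne_zero.2 (by finiteness)
  choose K hKA hK hKρ using fun n : ℕ =>
    hA.exists_isCompact_sdiff_lt (measure_ne_top ρ A) (hpos n)
  have hdiff : ∀ n, ∫ x in A \ K n, f x ∂ρ = ∫ x in A, f x ∂ρ := fun n => by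
    rw [setIntegral_sdiff (hK n).measurableSet hf.integrableOn (hKA n),
      setIntegral_eq_zero_of_isCompact hf hF (hK n) (measure_mono_null (hKA n) h0), sub_zero]
  have hsmall : Filter.Tendsto (fun n => ρ (A \ K n)) Filter.atTop (nhds 0) := by
    refine tendsto_of_tendsto_of_tendsto_of_le_of_le tendsto_const_nhds ?_ (fun _ => zero_le)
      fun n => (hKρ n).le
    simpa [Function.comp_def] using
      ENNReal.tendsto_inv_nat_nhds_zero.comp (Filter.tendsto_add_atTop_nat 1)
  have := hf.tendsto_setIntegral_nhds_zero hsmall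
  simp_rw [hdiff] at this
  exact tendsto_nhds_unique tendsto_const_nhds this
end

section
/- Let (Ω, Σ) be a measurable space and let T be a linear bijection of the space of finite signed measures on (Ω, Σ) onto itself that preserves the total variation norm, i.e. ‖Tμ‖ = ‖μ‖ for every finite signed measure μ. Then two finite signed measures μ and σ are mutually singular if and only if Tμ and Tσ are mutually singular. -/
open MeasureTheory
open scoped MeasureTheory

namespace MeasureTheory.SignedMeasure

variable {Ω : Type*} [MeasurableSpace Ω]

theorem apply_eq_inter_add_inter_compl (s : SignedMeasure Ω) {A B : Set Ω}
    (hA : MeasurableSet A) (hB : MeasurableSet B) : s A = s (A ∩ B) + s (A ∩ Bᶜ) := by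
  rw [← VectorMeasure.of_union (disjoint_compl_right.mono Set.inter_subset_right
    Set.inter_subset_right) (hA.inter hB) (hA.inter hB.compl), Set.inter_union_compl]

theorem apply_sub_apply_compl_le_totalVariation (s : SignedMeasure Ω) {P : Set Ω}
    (hP : MeasurableSet P) : s P - s Pᶜ ≤ s.totalVariation.real Set.univ := by
  have h1 := s.apply_eq_posPart_real_sub_negPart_real hP
  have h2 := s.apply_eq_posPart_real_sub_negPart_real hP.compl
  have h3 : s.totalVariation.real Set.univ = s.toJordanDecomposition.posPart.real Set.univ +
      s.toJordanDecomposition.negPart.real Set.univ := by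
    rw [totalVariation, measureReal_add_apply]
  have h4 := measureReal_add_measureReal_compl (μ := s.toJordanDecomposition.posPart) hP
  have h5 := measureReal_add_measureReal_compl (μ := s.toJordanDecomposition.negPart) hP
  have h6 : 0 ≤ s.toJordanDecomposition.posPart.real Pᶜ := measureReal_nonneg
  have h7 : 0 ≤ s.toJordanDecomposition.negPart.real P := measureReal_nonneg
  linarith

theorem exists_apply_sub_apply_compl_eq_totalVariation (s : SignedMeasure Ω) :
    ∃ P, MeasurableSet P ∧ s P - s Pᶜ = s.totalVariation.real Set.univ := by
  obtain ⟨P, hP, hpos, hneg, h1, h2⟩ := s.toJordanDecomposition_spec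
  refine ⟨P, hP, ?_⟩
  rw [totalVariation, measureReal_add_apply, h1, h2,
    toMeasureOfZeroLE_real_apply _ hpos hP MeasurableSet.univ,
    toMeasureOfLEZero_real_apply _ hneg hP.compl MeasurableSet.univ, Set.inter_univ,
    Set.inter_univ, sub_eq_add_neg]

theorem nonneg_of_totalVariation_le {s : SignedMeasure Ω} {P A : Set Ω}
    (hP : MeasurableSet P) (h : s.totalVariation.real Set.univ ≤ s P - s Pᶜ)
    (hA : MeasurableSet A) (hAP : A ⊆ P) : 0 ≤ s A := by
  have h1 := s.apply_sub_apply_compl_le_totalVariation (hP.diff hA)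
  have h2 : s A + s (P \ A) = s P := VectorMeasure.of_add_of_sdiff hA hP hAP
  have h3 : s (P \ A)ᶜ = s Pᶜ + s A := by
    rw [← VectorMeasure.of_union (disjoint_compl_left.mono_right hAP) hP.compl hA,
      Set.sdiff_eq, Set.compl_inter, compl_compl]
  linarith

theorem nonpos_of_totalVariation_le {s : SignedMeasure Ω} {P A : Set Ω}
    (hP : MeasurableSet P) (h : s.totalVariation.real Set.univ ≤ s P - s Pᶜ)
    (hA : MeasurableSet A) (hAP : A ⊆ Pᶜ) : s A ≤ 0 := by
  have h1 : 0 ≤ (-s) A := by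
    refine nonneg_of_totalVariation_le hP.compl ?_ hA hAP
    simp only [totalVariation_neg, compl_compl, neg_apply]
    linarith
  simpa using h1

theorem totalVariation_add_le_of_mutuallySingular {μ σ : SignedMeasure Ω} (h : μ ⟂ᵥ σ) :
    μ.totalVariation.real Set.univ + σ.totalVariation.real Set.univ ≤
      (μ + σ).totalVariation.real Set.univ := by
  obtain ⟨D, hD, hμ, hσ⟩ := h
  obtain ⟨P, hP, hPμ⟩ := μ.exists_apply_sub_apply_compl_eq_totalVariation
  obtain ⟨Q, hQ, hQσ⟩ := σ.exists_apply_sub_apply_compl_eq_totalVariation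
  set R := (P ∩ Dᶜ) ∪ (Q ∩ D) with hR_def
  have hR : MeasurableSet R := (hP.inter hD.compl).union (hQ.inter hD)
  have key := (μ + σ).apply_sub_apply_compl_le_totalVariation hR
  have hμ' : ∀ A, MeasurableSet A → μ A = μ (A ∩ Dᶜ) := fun A hA => by
    rw [μ.apply_eq_inter_add_inter_compl hA hD, hμ _ Set.inter_subset_right, zero_add]
  have hσ' : ∀ A, MeasurableSet A → σ A = σ (A ∩ D) := fun A hA => by
    rw [σ.apply_eq_inter_add_inter_compl hA hD, hσ _ Set.inter_subset_right, add_zero]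
  have e1 : μ R = μ P := by
    rw [hμ' R hR, hμ' P hP]; congr 1; ext x; simp [hR_def]; tauto
  have e2 : μ Rᶜ = μ Pᶜ := by
    rw [hμ' _ hR.compl, hμ' _ hP.compl]; congr 1; ext x; simp [hR_def]; tauto
  have e3 : σ R = σ Q := by
    rw [hσ' R hR, hσ' Q hQ]; congr 1; ext x; simp [hR_def]; tauto
  have e4 : σ Rᶜ = σ Qᶜ := by
    rw [hσ' _ hR.compl, hσ' _ hQ.compl]; congr 1; ext x; simp [hR_def]; tauto
  simp only [add_apply, e1, e2, e3, e4] at key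
  linarith

theorem exists_common_hahn_of_totalVariation_add_le {μ σ : SignedMeasure Ω}
    (h : μ.totalVariation.real Set.univ + σ.totalVariation.real Set.univ ≤
      (μ + σ).totalVariation.real Set.univ) :
    ∃ P, MeasurableSet P ∧ (∀ A, MeasurableSet A → A ⊆ P → 0 ≤ μ A ∧ 0 ≤ σ A) ∧
      ∀ A, MeasurableSet A → A ⊆ Pᶜ → μ A ≤ 0 ∧ σ A ≤ 0 := by
  obtain ⟨P, hP, hPμσ⟩ := (μ + σ).exists_apply_sub_apply_compl_eq_totalVariation
  simp only [add_apply] at hPμσ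
  have h1 := μ.apply_sub_apply_compl_le_totalVariation hP
  have h2 := σ.apply_sub_apply_compl_le_totalVariation hP
  have hμ : μ.totalVariation.real Set.univ ≤ μ P - μ Pᶜ := by linarith
  have hσ : σ.totalVariation.real Set.univ ≤ σ P - σ Pᶜ := by linarith
  exact ⟨P, hP, fun A hA hAP => ⟨nonneg_of_totalVariation_le hP hμ hA hAP,
    nonneg_of_totalVariation_le hP hσ hA hAP⟩, fun A hA hAP =>
    ⟨nonpos_of_totalVariation_le hP hμ hA hAP, nonpos_of_totalVariation_le hP hσ hA hAP⟩⟩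

/-- Two signed measures are mutually singular iff the total variation norm is additive on both
their sum and their difference. -/
theorem mutuallySingular_iff_totalVariation_add_le (μ σ : SignedMeasure Ω) :
    μ ⟂ᵥ σ ↔
      μ.totalVariation.real Set.univ + σ.totalVariation.real Set.univ ≤
        (μ + σ).totalVariation.real Set.univ ∧
      μ.totalVariation.real Set.univ + σ.totalVariation.real Set.univ ≤
        (μ - σ).totalVariation.real Set.univ := by
  constructor
  · intro h
    refine ⟨totalVariation_add_le_of_mutuallySingular h, ?_⟩
    simpa only [totalVariation_neg, ← sub_eq_add_neg] using
      totalVariation_add_le_of_mutuallySingular h.neg_right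
  · rintro ⟨h1, h2⟩
    rw [sub_eq_add_neg, ← totalVariation_neg σ] at h2
    obtain ⟨P, hP, hPpos, hPneg⟩ := exists_common_hahn_of_totalVariation_add_le h1
    obtain ⟨Q, hQ, hQpos, hQneg⟩ := exists_common_hahn_of_totalVariation_add_le h2
    simp only [neg_apply, Left.nonneg_neg_iff, Left.neg_nonpos_iff] at hQpos hQneg
    refine VectorMeasure.MutuallySingular.mk ((P ∩ Qᶜ) ∪ (Pᶜ ∩ Q))
      ((hP.inter hQ.compl).union (hP.compl.inter hQ)) (fun A hAD hA => ?_) fun A hAD hA => ?_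
    · have hA1 : A ∩ Pᶜ ⊆ Q := fun x hx => by have := hAD hx.1; have := hx.2; simp_all
      have hA2 : A ∩ P ⊆ Qᶜ := fun x hx => by have := hAD hx.1; have := hx.2; simp_all
      have a1 := hPpos _ (hA.inter hP) Set.inter_subset_right
      have a2 := hQneg _ (hA.inter hP) hA2
      have a3 := hPneg _ (hA.inter hP.compl) Set.inter_subset_right
      have a4 := hQpos _ (hA.inter hP.compl) hA1
      linarith [μ.apply_eq_inter_add_inter_compl hA hP]
    · have hA1 : A ∩ P ⊆ Q := fun x hx => by have := hAD hx.1; have := hx.2; simp_all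
      have hA2 : A ∩ Pᶜ ⊆ Qᶜ := fun x hx => by have := hAD hx.1; have := hx.2; simp_all
      have a1 := hPpos _ (hA.inter hP) Set.inter_subset_right
      have a2 := hQpos _ (hA.inter hP) hA1
      have a3 := hPneg _ (hA.inter hP.compl) Set.inter_subset_right
      have a4 := hQneg _ (hA.inter hP.compl) hA2
      linarith [σ.apply_eq_inter_add_inter_compl hA hP]

end MeasureTheory.SignedMeasure

theorem stmt8 {Ω : Type*} [MeasurableSpace Ω]
    (T : SignedMeasure Ω →ₗ[ℝ] SignedMeasure Ω) (hbij : Function.Bijective T)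
    (hiso : ∀ μ : SignedMeasure Ω,
      (T μ).totalVariation Set.univ = μ.totalVariation Set.univ)
    (μ σ : SignedMeasure Ω) :
    μ ⟂ᵥ σ ↔ T μ ⟂ᵥ T σ := by
  simp only [SignedMeasure.mutuallySingular_iff_totalVariation_add_le, ← map_add, ← map_sub,
    measureReal_def, hiso]
end

section
/- Let (Ω, Σ) be a measurable space and let T be a linear bijection of the space of finite signed measures on (Ω, Σ) onto itself that preserves the total variation norm, i.e. ‖Tμ‖ = ‖μ‖ for every finite signed measure μ. Then for finite signed measures μ and σ, μ is absolutely continuous with respect to σ if and only if Tμ is absolutely continuous with respect to Tσ. -/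
open MeasureTheory

namespace MeasureTheory.SignedMeasure

variable {Ω : Type*} [MeasurableSpace Ω]

instance isFiniteMeasure_totalVariation (μ : SignedMeasure Ω) :
    IsFiniteMeasure μ.totalVariation := by
  unfold totalVariation
  infer_instance

/-- The total mass exceeds `μ P - μ Pᶜ` by twice the mass `P` fails to place correctly. -/
theorem totalVariation_real_univ (μ : SignedMeasure Ω) {P : Set Ω} (hP : MeasurableSet P) :
    μ.totalVariation.real Set.univ = μ P - μ Pᶜ +
      2 * (μ.toJordanDecomposition.negPart.real P + μ.toJordanDecomposition.posPart.real Pᶜ) := by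
  rw [totalVariation, measureReal_add_apply, apply_eq_posPart_real_sub_negPart_real μ hP,
    apply_eq_posPart_real_sub_negPart_real μ hP.compl,
    ← measureReal_add_measureReal_compl (μ := μ.toJordanDecomposition.posPart) hP,
    ← measureReal_add_measureReal_compl (μ := μ.toJordanDecomposition.negPart) hP]
  ring

theorem apply_sub_apply_compl_le (μ : SignedMeasure Ω) {P : Set Ω} (hP : MeasurableSet P) :
    μ P - μ Pᶜ ≤ μ.totalVariation.real Set.univ := by
  rw [totalVariation_real_univ μ hP]
  have := measureReal_nonneg (μ := μ.toJordanDecomposition.negPart) (s := P)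
  have := measureReal_nonneg (μ := μ.toJordanDecomposition.posPart) (s := Pᶜ)
  linarith

theorem exists_apply_sub_apply_compl_eq (μ : SignedMeasure Ω) :
    ∃ P, MeasurableSet P ∧ μ P - μ Pᶜ = μ.totalVariation.real Set.univ := by
  obtain ⟨S, hS, h₁, h₂⟩ := μ.toJordanDecomposition.mutuallySingular
  refine ⟨Sᶜ, hS.compl, ?_⟩
  rw [totalVariation_real_univ μ hS.compl, compl_compl, measureReal_def, measureReal_def, h₁, h₂]
  simp

theorem null_of_apply_sub_apply_compl_eq (μ : SignedMeasure Ω) {P : Set Ω} (hP : MeasurableSet P)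
    (h : μ P - μ Pᶜ = μ.totalVariation.real Set.univ) :
    μ.toJordanDecomposition.negPart P = 0 ∧ μ.toJordanDecomposition.posPart Pᶜ = 0 := by
  rw [totalVariation_real_univ μ hP] at h
  have h₁ := measureReal_nonneg (μ := μ.toJordanDecomposition.negPart) (s := P)
  have h₂ := measureReal_nonneg (μ := μ.toJordanDecomposition.posPart) (s := Pᶜ)
  rw [← measureReal_eq_zero_iff, ← measureReal_eq_zero_iff]
  constructor <;> linarith

theorem totalVariation_real_univ_add_le (μ ν : SignedMeasure Ω) :
    (μ + ν).totalVariation.real Set.univ ≤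
      μ.totalVariation.real Set.univ + ν.totalVariation.real Set.univ := by
  obtain ⟨P, hP, h⟩ := exists_apply_sub_apply_compl_eq (μ + ν)
  have h₁ := apply_sub_apply_compl_le μ hP
  have h₂ := apply_sub_apply_compl_le ν hP
  simp only [add_apply] at h
  linarith

theorem apply_eq_apply_of_null_sdiff (μ : SignedMeasure Ω) {A B S : Set Ω}
    (hA : MeasurableSet A) (hB : MeasurableSet B) (hS : MeasurableSet S)
    (hμ : μ.totalVariation S = 0) (h : A ∩ Sᶜ = B ∩ Sᶜ) : μ A = μ B := by
  have key {C : Set Ω} (hC : MeasurableSet C) : μ C = μ (C ∩ Sᶜ) := by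
    have h₀ : μ (C ∩ S) = 0 :=
      null_of_totalVariation_zero μ (measure_mono_null Set.inter_subset_right hμ)
    rw [← Set.inter_union_compl C S, VectorMeasure.of_union _ (hC.inter hS) (hC.inter hS.compl),
      h₀, zero_add, Set.inter_union_compl]
    exact disjoint_compl_right.mono Set.inter_subset_right Set.inter_subset_right
  rw [key hA, key hB, h]

theorem totalVariation_real_univ_add_of_mutuallySingular {μ ν : SignedMeasure Ω}
    (h : μ.totalVariation ⟂ₘ ν.totalVariation) :
    (μ + ν).totalVariation.real Set.univ =
      μ.totalVariation.real Set.univ + ν.totalVariation.real Set.univ := by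
  refine (totalVariation_real_univ_add_le μ ν).antisymm ?_
  obtain ⟨S, hS, hμ, hν⟩ := h
  obtain ⟨P, hP, hPμ⟩ := exists_apply_sub_apply_compl_eq μ
  obtain ⟨Q, hQ, hQν⟩ := exists_apply_sub_apply_compl_eq ν
  have hR : MeasurableSet (P ∩ Sᶜ ∪ Q ∩ S) := (hP.inter hS.compl).union (hQ.inter hS)
  have h₀ := apply_sub_apply_compl_le (μ + ν) hR
  simp only [add_apply] at h₀
  rw [apply_eq_apply_of_null_sdiff μ hR hP hS hμ (by ext; simp; tauto),
    apply_eq_apply_of_null_sdiff μ hR.compl hP.compl hS hμ (by ext; simp; tauto),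
    apply_eq_apply_of_null_sdiff ν hR hQ hS.compl hν (by ext; simp; tauto),
    apply_eq_apply_of_null_sdiff ν hR.compl hQ.compl hS.compl hν (by ext; simp; tauto)] at h₀
  linarith

theorem null_of_totalVariation_real_univ_add (μ ν : SignedMeasure Ω)
    (h : (μ + ν).totalVariation.real Set.univ =
      μ.totalVariation.real Set.univ + ν.totalVariation.real Set.univ) :
    ∃ P, MeasurableSet P ∧
      (μ.toJordanDecomposition.negPart P = 0 ∧ μ.toJordanDecomposition.posPart Pᶜ = 0) ∧
      (ν.toJordanDecomposition.negPart P = 0 ∧ ν.toJordanDecomposition.posPart Pᶜ = 0) := by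
  obtain ⟨P, hP, hPeq⟩ := exists_apply_sub_apply_compl_eq (μ + ν)
  have h₁ := apply_sub_apply_compl_le μ hP
  have h₂ := apply_sub_apply_compl_le ν hP
  simp only [add_apply] at hPeq
  exact ⟨P, hP, null_of_apply_sub_apply_compl_eq μ hP (by linarith),
    null_of_apply_sub_apply_compl_eq ν hP (by linarith)⟩

/-- Mutual singularity is a property of the total variation norm. -/
theorem totalVariation_mutuallySingular_iff_real_univ (μ ν : SignedMeasure Ω) :
    μ.totalVariation ⟂ₘ ν.totalVariation ↔
      (μ + ν).totalVariation.real Set.univ =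
        μ.totalVariation.real Set.univ + ν.totalVariation.real Set.univ ∧
      (μ - ν).totalVariation.real Set.univ =
        μ.totalVariation.real Set.univ + ν.totalVariation.real Set.univ := by
  constructor
  · intro h
    refine ⟨totalVariation_real_univ_add_of_mutuallySingular h, ?_⟩
    rw [← totalVariation_neg ν] at h ⊢
    rw [sub_eq_add_neg]
    exact totalVariation_real_univ_add_of_mutuallySingular h
  · rintro ⟨h₁, h₂⟩
    rw [sub_eq_add_neg, ← totalVariation_neg ν] at h₂
    obtain ⟨P, hP, ⟨hμP, hμP'⟩, hνP, hνP'⟩ := null_of_totalVariation_real_univ_add _ _ h₁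
    obtain ⟨Q, hQ, ⟨hμQ, hμQ'⟩, hνQ, hνQ'⟩ := null_of_totalVariation_real_univ_add _ _ h₂
    rw [toJordanDecomposition_neg, JordanDecomposition.neg_negPart] at hνQ
    rw [toJordanDecomposition_neg, JordanDecomposition.neg_posPart] at hνQ'
    refine ⟨P ∩ Qᶜ ∪ Pᶜ ∩ Q, (hP.inter hQ.compl).union (hP.compl.inter hQ), ?_, ?_⟩
    · simp only [totalVariation, Measure.add_apply, measure_union_null_iff, add_eq_zero]
      exact ⟨⟨measure_mono_null Set.inter_subset_right hμQ',
        measure_mono_null Set.inter_subset_left hμP'⟩,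
        measure_mono_null Set.inter_subset_left hμP,
        measure_mono_null Set.inter_subset_right hμQ⟩
    · have hcompl : (P ∩ Qᶜ ∪ Pᶜ ∩ Q)ᶜ = P ∩ Q ∪ Pᶜ ∩ Qᶜ := by ext; simp; tauto
      rw [hcompl]
      simp only [totalVariation, Measure.add_apply, measure_union_null_iff, add_eq_zero]
      exact ⟨⟨measure_mono_null Set.inter_subset_right hνQ,
        measure_mono_null Set.inter_subset_left hνP'⟩,
        measure_mono_null Set.inter_subset_left hνP,
        measure_mono_null Set.inter_subset_right hνQ'⟩

theorem totalVariation_eq_zero_of_forall_subset (μ : SignedMeasure Ω) {A : Set Ω}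
    (hA : MeasurableSet A) (h : ∀ B ⊆ A, MeasurableSet B → μ B = 0) :
    μ.totalVariation A = 0 := by
  obtain ⟨S, hS, h₁, h₂⟩ := μ.toJordanDecomposition.mutuallySingular
  have hp := h (A ∩ Sᶜ) Set.inter_subset_left (hA.inter hS.compl)
  have hn := h (A ∩ S) Set.inter_subset_left (hA.inter hS)
  have hpos := measure_mono_null (Set.inter_subset_right (s := A)) h₁
  have hneg := measure_mono_null (Set.inter_subset_right (s := A)) h₂
  rw [apply_eq_posPart_real_sub_negPart_real μ (hA.inter hS.compl),
    (measureReal_eq_zero_iff).mpr hneg, sub_zero, measureReal_eq_zero_iff] at hp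
  rw [apply_eq_posPart_real_sub_negPart_real μ (hA.inter hS),
    (measureReal_eq_zero_iff).mpr hpos, zero_sub, neg_eq_zero, measureReal_eq_zero_iff] at hn
  rw [← Set.inter_union_compl A S]
  simp only [totalVariation, Measure.add_apply, measure_union_null_iff, add_eq_zero]
  exact ⟨⟨hpos, hp⟩, hn, hneg⟩

/-- Absolute continuity is determined by the mutual singularity relation. -/
theorem forall_null_iff_forall_mutuallySingular (μ σ : SignedMeasure Ω) :
    (∀ A : Set Ω, MeasurableSet A → σ.totalVariation A = 0 → μ A = 0) ↔
      ∀ ν : SignedMeasure Ω, ν.totalVariation ⟂ₘ σ.totalVariation →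
        ν.totalVariation ⟂ₘ μ.totalVariation := by
  constructor
  · rintro h ν ⟨S, hS, hν, hσ⟩
    exact ⟨S, hS, hν, totalVariation_eq_zero_of_forall_subset μ hS.compl
      fun B hB hBm => h B hBm (measure_mono_null hB hσ)⟩
  · intro h A hA hσ
    have hν : totalVariation (μ.restrict A) Aᶜ = 0 := by
      refine totalVariation_eq_zero_of_forall_subset _ hA.compl fun B hB hBm => ?_
      rw [VectorMeasure.restrict_apply _ hA hBm,
        Set.disjoint_iff_inter_eq_empty.1 (disjoint_compl_left.mono_left hB),
        VectorMeasure.empty]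
    obtain ⟨S, hS, h₁, h₂⟩ := h (μ.restrict A) ⟨Aᶜ, hA.compl, hν, by rwa [compl_compl]⟩
    have h₃ := null_of_totalVariation_zero _ h₁
    rw [VectorMeasure.restrict_apply _ hA hS] at h₃
    have h₄ : μ (Sᶜ ∩ A) = 0 :=
      null_of_totalVariation_zero _ (measure_mono_null Set.inter_subset_left h₂)
    rw [← Set.inter_union_compl A S, Set.inter_comm A S, Set.inter_comm A Sᶜ,
      VectorMeasure.of_union _ (hS.inter hA) (hS.compl.inter hA), h₃, h₄, add_zero]
    exact disjoint_compl_right.mono Set.inter_subset_left Set.inter_subset_left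

end MeasureTheory.SignedMeasure

theorem stmt9 {Ω : Type*} [MeasurableSpace Ω]
    (T : SignedMeasure Ω →ₗ[ℝ] SignedMeasure Ω) (hbij : Function.Bijective T)
    (hiso : ∀ μ : SignedMeasure Ω,
      (T μ).totalVariation Set.univ = μ.totalVariation Set.univ)
    (μ σ : SignedMeasure Ω) :
    (∀ A : Set Ω, MeasurableSet A → σ.totalVariation A = 0 → μ A = 0) ↔
      (∀ A : Set Ω, MeasurableSet A → (T σ).totalVariation A = 0 → T μ A = 0) := by
  have hsing (ν τ : SignedMeasure Ω) : (T ν).totalVariation ⟂ₘ (T τ).totalVariation ↔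
      ν.totalVariation ⟂ₘ τ.totalVariation := by
    simp only [SignedMeasure.totalVariation_mutuallySingular_iff_real_univ, ← map_add, ← map_sub,
      measureReal_def, hiso]
  rw [SignedMeasure.forall_null_iff_forall_mutuallySingular,
    SignedMeasure.forall_null_iff_forall_mutuallySingular]
  exact ⟨fun h => hbij.2.forall.2 fun ν => by simpa only [hsing] using h ν,
    fun h ν => by simpa only [hsing] using h (T ν)⟩
end

section
/- Let μ and σ be finite signed measures on a measurable space (Ω, Σ). Then μ and σ are mutually singular if and only if ‖μ + σ‖ = ‖μ‖ + ‖σ‖ and ‖μ − σ‖ = ‖μ‖ + ‖σ‖. -/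
open MeasureTheory
open scoped MeasureTheory

namespace MeasureTheory.SignedMeasure

variable {Ω : Type*} [MeasurableSpace Ω]

/-- A signed measure agrees with its total variation on subsets of some measurable set, and with
the negative of its total variation on subsets of the complement. -/
lemma exists_totalVariation_real_eq (ν : SignedMeasure Ω) :
    ∃ H : Set Ω, MeasurableSet H ∧
      (∀ E ⊆ H, MeasurableSet E → ν.totalVariation.real E = ν E) ∧
      ∀ E ⊆ Hᶜ, MeasurableSet E → ν.totalVariation.real E = -ν E := by
  obtain ⟨S, hS, hpos, hneg⟩ := ν.toJordanDecomposition.mutuallySingular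
  refine ⟨Sᶜ, hS.compl, fun E hE hEm ↦ ?_, fun E hE hEm ↦ ?_⟩
  · have h : ν.toJordanDecomposition.negPart.real E = 0 := by
      simp [measureReal_def, measure_mono_null hE hneg]
    rw [apply_eq_posPart_real_sub_negPart_real ν hEm, totalVariation, measureReal_add_apply, h]
    ring
  · have h : ν.toJordanDecomposition.posPart.real E = 0 := by
      simp [measureReal_def, measure_mono_null (by simpa using hE) hpos]
    rw [apply_eq_posPart_real_sub_negPart_real ν hEm, totalVariation, measureReal_add_apply, h]
    ring

lemma totalVariation_add_le (μ σ : SignedMeasure Ω) :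
    (μ + σ).totalVariation ≤ μ.totalVariation + σ.totalVariation := by
  simpa only [totalVariation_eq_variation] using VectorMeasure.variation_add_le

lemma totalVariation_sub_le (μ σ : SignedMeasure Ω) :
    (μ - σ).totalVariation ≤ μ.totalVariation + σ.totalVariation := by
  simpa only [totalVariation_eq_variation] using VectorMeasure.variation_sub_le

lemma mutuallySingular_of_totalVariation_add_eq_sub {μ σ : SignedMeasure Ω}
    (h : (μ + σ).totalVariation = (μ - σ).totalVariation) : μ ⟂ᵥ σ := by
  obtain ⟨H, hH, hH₁, hH₂⟩ := (μ + σ).exists_totalVariation_real_eq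
  obtain ⟨K, hK, hK₁, hK₂⟩ := (μ - σ).exists_totalVariation_real_eq
  rw [h] at hH₁ hH₂
  simp only [add_apply, sub_apply] at hH₁ hH₂ hK₁ hK₂
  have split (ν : SignedMeasure Ω) {E : Set Ω} (hE : MeasurableSet E) :
      ν E = ν (E ∩ H) + ν (E ∩ Hᶜ) := by
    rw [← VectorMeasure.of_union _ (hE.inter hH) (hE.inter hH.compl), Set.inter_union_compl]
    exact disjoint_compl_right.mono Set.inter_subset_right Set.inter_subset_right
  refine VectorMeasure.MutuallySingular.mk (symmDiff H K) (hH.symmDiff hK)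
    (fun E hE hEm ↦ ?_) fun E hE hEm ↦ ?_
  · have h₁ := hH₁ (E ∩ H) Set.inter_subset_right (hEm.inter hH)
    have h₂ := hH₂ (E ∩ Hᶜ) Set.inter_subset_right (hEm.inter hH.compl)
    have h₃ := hK₂ (E ∩ H) (by grind) (hEm.inter hH)
    have h₄ := hK₁ (E ∩ Hᶜ) (by grind) (hEm.inter hH.compl)
    linarith [split μ hEm]
  · have h₁ := hH₁ (E ∩ H) Set.inter_subset_right (hEm.inter hH)
    have h₂ := hH₂ (E ∩ Hᶜ) Set.inter_subset_right (hEm.inter hH.compl)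
    have h₃ := hK₁ (E ∩ H) (by grind) (hEm.inter hH)
    have h₄ := hK₂ (E ∩ Hᶜ) (by grind) (hEm.inter hH.compl)
    linarith [split σ hEm]

lemma totalVariation_add_univ_of_mutuallySingular {μ σ : SignedMeasure Ω} (h : μ ⟂ᵥ σ) :
    (μ + σ).totalVariation Set.univ
      = μ.totalVariation Set.univ + σ.totalVariation Set.univ := by
  refine le_antisymm (totalVariation_add_le μ σ Set.univ) ?_
  obtain ⟨D, hD, hμ, hσ⟩ := (mutuallySingular_iff μ σ).1 h
  have h₁ := totalVariation_sub_le (μ + σ) σ Dᶜ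
  have h₂ := totalVariation_sub_le (μ + σ) μ D
  rw [add_sub_cancel_right, Measure.add_apply, hσ, add_zero] at h₁
  rw [add_sub_cancel_left, Measure.add_apply, hμ, add_zero] at h₂
  rw [← measure_add_measure_compl (μ := μ.totalVariation) hD,
    ← measure_add_measure_compl (μ := σ.totalVariation) hD,
    ← measure_add_measure_compl (μ := (μ + σ).totalVariation) hD, hμ, hσ, zero_add, add_zero,
    add_comm]
  exact add_le_add h₂ h₁

end MeasureTheory.SignedMeasure

theorem stmt10 {Ω : Type*} [MeasurableSpace Ω] (μ σ : SignedMeasure Ω) :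
    μ ⟂ᵥ σ ↔
      ((μ + σ).totalVariation Set.univ
          = μ.totalVariation Set.univ + σ.totalVariation Set.univ
        ∧ (μ - σ).totalVariation Set.univ
          = μ.totalVariation Set.univ + σ.totalVariation Set.univ) := by
  refine ⟨fun h ↦ ⟨SignedMeasure.totalVariation_add_univ_of_mutuallySingular h, ?_⟩,
    fun ⟨hadd, hsub⟩ ↦ SignedMeasure.mutuallySingular_of_totalVariation_add_eq_sub ?_⟩
  · rw [sub_eq_add_neg, ← SignedMeasure.totalVariation_neg σ]
    exact SignedMeasure.totalVariation_add_univ_of_mutuallySingular h.neg_right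
  · rw [Measure.eq_of_le_of_measure_univ_eq (SignedMeasure.totalVariation_add_le μ σ) hadd,
      Measure.eq_of_le_of_measure_univ_eq (SignedMeasure.totalVariation_sub_le μ σ) hsub]
end

section
/- (Transference for translation on ℝ.) Let S ⊆ ℝ be a 𝒯-set. Let ν ∈ L¹(ℝ) satisfy ‖ν ⋆ g‖_{L¹(ℝ)} ≤ ‖g‖_{L¹(ℝ)} for every g ∈ L¹(ℝ) whose Fourier transform 𝓕g vanishes outside S. Let μ be a complex Borel measure on ℝ, represented by a pair (ρ, f), whose spectrum closure{s ∈ ℝ : μ̂(s) ≠ 0} is contained in S, where μ̂(s) = ∫_ℝ e^{−2πi s x} f(x) dρ(x). Then the function (ν ⋆ μ)(x) = ∫_ℝ ν(x − t) f(t) dρ(t) belongs to L¹(ℝ) and ‖ν ⋆ μ‖_{L¹(ℝ)} ≤ ∫_ℝ |f| dρ. -/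
open MeasureTheory Filter
open scoped FourierTransform Topology Pointwise

/-- A 𝒯-subset of ℝ. -/
def IsTSet (S : Set ℝ) : Prop :=
  ∀ K : Set ℝ, K ⊆ S → IsCompact K → ∀ U ∈ 𝓝 (0 : ℝ),
    ∃ W : Set ℝ, W ⊆ U ∧ IsOpen W ∧ W.Nonempty ∧ W + K ⊆ S

section ConvolutionWithMeasure

variable {ρ : Measure ℝ} [SFinite ρ] {f a : ℝ → ℂ}

lemma integrable_sub_mul_prod (ha : Integrable a) (hf : Integrable f ρ) :
    Integrable (fun p : ℝ × ℝ => a (p.1 - p.2) * f p.2) (volume.prod ρ) := by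
  simpa [mul_comm] using
    Integrable.convolution_integrand (ContinuousLinearMap.mul ℝ ℂ) hf ha

lemma integrable_integral_sub_mul (ha : Integrable a) (hf : Integrable f ρ) :
    Integrable (fun x : ℝ => ∫ t, a (x - t) * f t ∂ρ) :=
  (integrable_sub_mul_prod ha hf).integral_prod_left

lemma integral_norm_integral_sub_mul_le (ha : Integrable a) (hf : Integrable f ρ) :
    ∫ x : ℝ, ‖∫ t, a (x - t) * f t ∂ρ‖ ≤ (∫ x, ‖a x‖) * ∫ t, ‖f t‖ ∂ρ := by
  have hi := integrable_sub_mul_prod ha hf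
  calc ∫ x : ℝ, ‖∫ t, a (x - t) * f t ∂ρ‖
      ≤ ∫ x : ℝ, ∫ t, ‖a (x - t) * f t‖ ∂ρ :=
        integral_mono hi.integral_prod_left.norm hi.norm.integral_prod_left
          fun x => norm_integral_le_integral_norm _
    _ = ∫ t, (∫ x : ℝ, ‖a (x - t) * f t‖) ∂ρ := integral_integral_swap hi.norm
    _ = (∫ x, ‖a x‖) * ∫ t, ‖f t‖ ∂ρ := by
        simp_rw [norm_mul, integral_mul_const]
        rw [← integral_const_mul]
        refine integral_congr_ae (.of_forall fun t => ?_)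
        simp only
        rw [integral_sub_right_eq_self (fun x => ‖a x‖) t]

lemma integral_mul_integral_sub_mul_comm {c : ℝ → ℂ}
    (h : Integrable (fun p : ℝ × ℝ => c p.1 * (a (p.1 - p.2) * f p.2)) (volume.prod ρ)) :
    ∫ u : ℝ, c u * ∫ t, a (u - t) * f t ∂ρ = ∫ t, (∫ u : ℝ, c u * a (u - t)) * f t ∂ρ := by
  simp_rw [← integral_const_mul]
  rw [integral_integral_swap h]
  simp_rw [← mul_assoc, integral_mul_const]

lemma fourier_integral_sub_mul (ha : Integrable a) (hf : Integrable f ρ) (s : ℝ) :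
    𝓕 (fun u : ℝ => ∫ t, a (u - t) * f t ∂ρ) s = 𝓕 a s *
      ∫ x, Complex.exp (((-(2 * Real.pi * s * x) : ℝ) : ℂ) * Complex.I) * f x ∂ρ := by
  simp_rw [Real.fourier_real_eq_integral_exp_smul, smul_eq_mul]
  rw [integral_mul_integral_sub_mul_comm, ← integral_const_mul]
  · refine integral_congr_ae (.of_forall fun t => ?_)
    simp only
    rw [← mul_assoc]
    congr 1
    rw [← integral_add_right_eq_self _ t, ← integral_mul_const]
    refine integral_congr_ae (.of_forall fun u => ?_)
    simp only [add_sub_cancel_right]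
    rw [mul_right_comm (Complex.exp _) (a u), ← Complex.exp_add]
    congr 2
    push_cast
    ring
  · refine (integrable_sub_mul_prod ha hf).bdd_mul (c := 1) (by fun_prop) (.of_forall fun p => ?_)
    rw [Complex.norm_exp_ofReal_mul_I]

/-- Convolution by a bounded continuous function commutes with convolution by an integrable
function, applied to a measure. -/
lemma integral_sub_mul_integral_sub_mul_comm {b : ℝ → ℂ} {C : ℝ} (ha : Integrable a)
    (hf : Integrable f ρ) (hb : Continuous b) (hC : ∀ x, ‖b x‖ ≤ C) (x : ℝ) :
    ∫ u : ℝ, b (x - u) * ∫ t, a (u - t) * f t ∂ρ =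
      ∫ u : ℝ, a (x - u) * ∫ t, b (u - t) * f t ∂ρ := by
  rw [integral_mul_integral_sub_mul_comm, integral_mul_integral_sub_mul_comm]
  · refine integral_congr_ae (.of_forall fun t => ?_)
    simp only
    congr 1
    rw [← integral_sub_left_eq_self _ volume (x + t)]
    refine integral_congr_ae (.of_forall fun u => ?_)
    simp only
    rw [mul_comm]
    congr 2 <;> ring
  · have h := ((ha.comp_sub_left x).mul_prod hf).bdd_mul (c := C)
      (f := fun p : ℝ × ℝ => b (p.1 - p.2))
      (by fun_prop) (.of_forall fun p => hC _)
    refine h.congr (.of_forall fun p => ?_)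
    simp only
    ring
  · exact (integrable_sub_mul_prod ha hf).bdd_mul (c := C) (by fun_prop)
      (.of_forall fun p => hC _)

end ConvolutionWithMeasure

theorem stmt12 (S : Set ℝ) (hS : IsTSet S)
    (ν : ℝ → ℂ) (hν : Integrable ν)
    (hcontr : ∀ g : ℝ → ℂ, Integrable g → (∀ s : ℝ, s ∉ S → 𝓕 g s = 0) →
      ∫ x : ℝ, ‖∫ t : ℝ, ν (x - t) * g t‖ ≤ ∫ x : ℝ, ‖g x‖)
    (ρ : Measure ℝ) [IsFiniteMeasure ρ] (f : ℝ → ℂ) (hf : Integrable f ρ)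
    (hspec : closure {s : ℝ |
      (∫ x, Complex.exp (((-(2 * Real.pi * s * x) : ℝ) : ℂ) * Complex.I) * f x ∂ρ) ≠ 0}
      ⊆ S) :
    Integrable (fun x : ℝ => ∫ t, ν (x - t) * f t ∂ρ)
    ∧ ∫ x : ℝ, ‖∫ t, ν (x - t) * f t ∂ρ‖ ≤ ∫ t, ‖f t‖ ∂ρ := by
  have hh := integrable_integral_sub_mul hν hf
  refine ⟨hh, ?_⟩
  set h : ℝ → ℂ := fun x => ∫ t, ν (x - t) * f t ∂ρ with h_def
  let φ : ℕ → ContDiffBump (0 : ℝ) := fun n =>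
    { rIn := 1 / ((n : ℝ) + 1)
      rOut := 2 * (1 / ((n : ℝ) + 1))
      rIn_pos := by positivity
      rIn_lt_rOut := by
        have : 0 < 1 / ((n : ℝ) + 1) := by positivity
        linarith }
  let k : ℕ → ℝ → ℂ := fun n x => ((φ n).normed volume x : ℂ)
  have hk_int : ∀ n, Integrable (k n) := fun n => (φ n).integrable_normed.ofReal
  have hk_cont : ∀ n, Continuous (k n) := fun n =>
    Complex.continuous_ofReal.comp (φ n).continuous_normed
  have hk_norm : ∀ n, ∫ x, ‖k n x‖ = 1 := fun n => by
    simp only [k, Complex.norm_real, Real.norm_of_nonneg ((φ n).nonneg_normed _)]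
    exact (φ n).integral_normed
  have hk_bdd : ∀ n, ∃ C, ∀ x, ‖k n x‖ ≤ C := fun n =>
    ((φ n).hasCompactSupport_normed.comp_left (g := ((↑) : ℝ → ℂ))
      Complex.ofReal_zero).exists_bound_of_continuous (hk_cont n)
  let g : ℕ → ℝ → ℂ := fun n u => ∫ t, k n (u - t) * f t ∂ρ
  have hg_int : ∀ n, Integrable (g n) := fun n => integrable_integral_sub_mul (hk_int n) hf
  let H : ℕ → ℝ → ℂ := fun n x => ∫ u : ℝ, ν (x - u) * g n u
  have hH_int : ∀ n, Integrable (H n) := fun n => integrable_integral_sub_mul hν (hg_int n)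
  have hH_le : ∀ n, ∫ x, ‖H n x‖ ≤ ∫ t, ‖f t‖ ∂ρ := fun n => by
    refine (hcontr (g n) (hg_int n) fun s hs => ?_).trans ?_
    · rw [fourier_integral_sub_mul (hk_int n) hf]
      have : s ∉ {s : ℝ | (∫ x, Complex.exp (((-(2 * Real.pi * s * x) : ℝ) : ℂ) * Complex.I)
          * f x ∂ρ) ≠ 0} := fun h' => hs (hspec (subset_closure h'))
      rw [not_not.1 this, mul_zero]
    · simpa [hk_norm n] using integral_norm_integral_sub_mul_le (hk_int n) hf
  have hlim : ∀ᵐ x, Tendsto (fun n => H n x) atTop (𝓝 (h x)) := by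
    have hzero : Tendsto (fun n => (φ n).rOut) atTop (𝓝 0) := by
      simpa [φ] using tendsto_one_div_add_atTop_nhds_zero_nat.const_mul (2 : ℝ)
    filter_upwards [ContDiffBump.ae_convolution_tendsto_right_of_locallyIntegrable hzero
      (K := 2) (.of_forall fun n => le_rfl) hh.locallyIntegrable] with x hx
    refine hx.congr fun n => ?_
    obtain ⟨C, hC⟩ := hk_bdd n
    rw [convolution_eq_swap]
    simp only [ContinuousLinearMap.lsmul_apply, Complex.real_smul]
    exact integral_sub_mul_integral_sub_mul_comm hν hf (hk_cont n) hC x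
  rw [← ENNReal.ofReal_le_ofReal_iff (by positivity), ofReal_integral_norm_eq_lintegral_enorm hh]
  calc ∫⁻ x, ‖h x‖ₑ = ∫⁻ x, liminf (fun n => ‖H n x‖ₑ) atTop := by
        refine lintegral_congr_ae (hlim.mono fun x hx => ?_)
        exact hx.enorm.liminf_eq.symm
    _ ≤ liminf (fun n => ∫⁻ x, ‖H n x‖ₑ) atTop :=
        lintegral_liminf_le' fun n => (hH_int n).aestronglyMeasurable.enorm
    _ ≤ ENNReal.ofReal (∫ t, ‖f t‖ ∂ρ) := by
        refine liminf_le_of_frequently_le' (.of_forall fun n => ?_)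
        rw [← ofReal_integral_norm_eq_lintegral_enorm (hH_int n)]
        exact ENNReal.ofReal_le_ofReal (hH_le n)
end

section
/- Let S = {(x, y) ∈ ℝ² : y² ≤ x}. Then: (i) S is a 𝒯-subset of ℝ², i.e., for every compact K ⊆ S and every neighborhood U of (0,0) in ℝ² there is a nonempty open set W ⊆ U with W + K ⊆ S; and (ii) there is no nonempty open set W ⊆ ℝ² with W + S ⊆ S. -/
open scoped Topology Pointwise

theorem stmt13 :
    (∀ K : Set (ℝ × ℝ), K ⊆ {p : ℝ × ℝ | p.2 ^ 2 ≤ p.1} → IsCompact K →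
      ∀ U ∈ 𝓝 ((0, 0) : ℝ × ℝ),
        ∃ W : Set (ℝ × ℝ), W ⊆ U ∧ IsOpen W ∧ W.Nonempty ∧
          W + K ⊆ {p : ℝ × ℝ | p.2 ^ 2 ≤ p.1})
    ∧ ¬ ∃ W : Set (ℝ × ℝ), IsOpen W ∧ W.Nonempty ∧
        W + {p : ℝ × ℝ | p.2 ^ 2 ≤ p.1} ⊆ {p : ℝ × ℝ | p.2 ^ 2 ≤ p.1} := by
  constructor
  · intro K hKS hK U hU
    obtain ⟨ε, hε, hεU⟩ := Metric.mem_nhds_iff.mp hU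
    obtain ⟨M, hM⟩ := hK.isBounded.exists_norm_le
    refine ⟨Metric.ball (0, 0) ε ∩ {p | 2 * M * |p.2| + p.2 ^ 2 < p.1},
      Set.inter_subset_left.trans hεU,
      Metric.isOpen_ball.inter (isOpen_lt (by fun_prop) (by fun_prop)), ⟨(ε / 2, 0), ?_, ?_⟩, ?_⟩
    · rw [Metric.mem_ball, Prod.dist_eq]
      simp [abs_of_pos hε, hε]
    · simp [hε]
    · rintro _ ⟨⟨a, b⟩, ⟨-, hab⟩, ⟨x, y⟩, hxy, rfl⟩
      have hS : y ^ 2 ≤ x := hKS hxy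
      have hy : |y| ≤ M := (norm_snd_le (x, y)).trans (hM _ hxy)
      have hyb : y * b ≤ M * |b| :=
        (le_abs_self _).trans (by rw [abs_mul]; gcongr)
      simp only [Set.mem_ofPred_eq] at hab
      change (b + y) ^ 2 ≤ a + x
      linarith [add_sq b y]
  · rintro ⟨W, hW, ⟨⟨a, b₀⟩, hab₀⟩, hWS⟩
    obtain ⟨b, hab, hb⟩ := (dense_compl_singleton (0 : ℝ)).inter_open_nonempty
      ((fun b : ℝ => (a, b)) ⁻¹' W) (hW.preimage (by fun_prop)) ⟨b₀, hab₀⟩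
    have hb : b ≠ 0 := hb
    have h : (b + a / (2 * b)) ^ 2 ≤ a + (a / (2 * b)) ^ 2 :=
      hWS (Set.add_mem_add hab
        (show ((a / (2 * b)) ^ 2, a / (2 * b)) ∈ {p : ℝ × ℝ | p.2 ^ 2 ≤ p.1} by simp))
    have hcross : 2 * b * (a / (2 * b)) = a := by field_simp
    linarith [add_sq b (a / (2 * b)), sq_pos_of_ne_zero hb]
end

section
/- Let μ be a complex Borel measure on ℝ, represented by a pair (ρ, f), and let E ⊆ ℝ be a Borel set such that the bounded function t ↦ μ(E + t) is Borel measurable. Let g ∈ L¹(ℝ). Then for every χ ∈ ℝ that does not belong to the sum set closure{s : 𝓕g(s) ≠ 0} + closure{s : μ̂(s) ≠ 0}, one has ∫_ℝ g(t)·μ(E + t)·e^{−2πi χ t} dt = 0. -/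
open MeasureTheory Filter
open scoped FourierTransform Pointwise

theorem ae_eq_zero_of_fourier_eq_zero {k : ℝ → ℂ} (hk : Integrable k)
    (h : ∀ s, 𝓕 k s = 0) : ∀ᵐ x, k x = 0 := by
  refine ae_eq_zero_of_integral_contDiff_smul_eq_zero hk.locallyIntegrable fun φ hφ hc ↦ ?_
  have hc' : HasCompactSupport (Complex.ofRealCLM ∘ φ) := hc.comp_left rfl
  have hφ' : ContDiff ℝ (⊤ : ℕ∞) (Complex.ofRealCLM ∘ φ) :=
    Complex.ofRealCLM.contDiff.comp hφ
  let ψ := hc'.toSchwartzMap hφ'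
  have hself : ∫ ξ, 𝓕 (𝓕⁻ ψ : SchwartzMap ℝ ℂ) ξ • k ξ =
      ∫ x, (𝓕⁻ ψ : SchwartzMap ℝ ℂ) x • 𝓕 k x := by
    rw [SchwartzMap.fourier_coe]
    simpa using! VectorFourier.integral_fourierIntegral_smul_eq_flip (L := innerₗ ℝ)
      Real.continuous_fourierChar continuous_inner (𝓕⁻ ψ : SchwartzMap ℝ ℂ).integrable hk
  rw [FourierTransform.fourier_fourierInv_eq] at hself
  simpa [h, ψ] using hself

theorem exp_eq_fourierChar (s x : ℝ) :
    Complex.exp (((-(2 * Real.pi * s * x) : ℝ) : ℂ) * Complex.I) = Real.fourierChar (-(s * x)) := by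
  rw [Real.fourierChar_apply]
  rw [mul_neg, mul_assoc]

theorem fourier_eq_integral_fourierChar_mul (g : ℝ → ℂ) (s : ℝ) :
    𝓕 g s = ∫ x, (Real.fourierChar (-(s * x)) : ℂ) * g x := by
  simp [Real.fourier_eq, Circle.smul_def]

theorem integrable_fourierChar_mul {α : Type*} [MeasurableSpace α] {ν : Measure α} {G : α → ℂ}
    (hG : Integrable G ν) {p : α → ℝ} (hp : Measurable p) :
    Integrable (fun a ↦ (Real.fourierChar (p a) : ℂ) * G a) ν :=
  hG.bdd_mul (c := 1)
    (by fun_prop) (.of_forall fun a ↦ (Circle.norm_coe (Real.fourierChar (p a))).le)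

section Correlation

variable {ρ : Measure ℝ} [IsFiniteMeasure ρ] {f h : ℝ → ℂ}

theorem integrable_correlation_integrand (hf : Integrable f ρ) (hh : Integrable h) :
    Integrable (fun p : ℝ × ℝ ↦ f p.2 * h (p.2 - p.1)) (volume.prod ρ) := by
  simpa using hf.convolution_integrand (ContinuousLinearMap.mul ℝ ℂ) hh.comp_neg

theorem fourier_correlation (hf : Integrable f ρ) (hh : Integrable h) (s : ℝ) :
    𝓕 (fun u ↦ ∫ x, f x * h (x - u) ∂ρ) s =
      (∫ x, (Real.fourierChar (-(s * x)) : ℂ) * f x ∂ρ) * 𝓕 h (-s) := by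
  have hint := integrable_fourierChar_mul (integrable_correlation_integrand hf hh)
    (p := fun p ↦ -(s * p.1)) (by fun_prop)
  rw [fourier_eq_integral_fourierChar_mul, fourier_eq_integral_fourierChar_mul,
    ← integral_mul_const]
  simp_rw [← integral_const_mul]
  rw [integral_integral_swap hint]
  refine integral_congr_ae (.of_forall fun x ↦ ?_)
  dsimp only
  rw [← integral_sub_left_eq_self _ volume x]
  refine integral_congr_ae (.of_forall fun v ↦ ?_)
  have hs : -(s * (x - v)) = -(s * x) + -(-s * v) := by ring
  simp only [sub_sub_cancel, hs, AddChar.map_add_eq_mul, Circle.coe_mul]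
  ring

theorem integral_mul_setIntegral_translate (hf : Integrable f ρ) (hh : Integrable h)
    {E : Set ℝ} (hE : MeasurableSet E) :
    ∫ t, h t * ∫ x in (· + t) '' E, f x ∂ρ = ∫ u in E, ∫ x, f x * h (x - u) ∂ρ := by
  have himage (t : ℝ) : (· + t) '' E = (fun x ↦ x - t) ⁻¹' E := by
    simp [sub_eq_add_neg]
  have hmeas : MeasurableSet {p : ℝ × ℝ | p.2 - p.1 ∈ E} :=
    (measurable_snd.sub measurable_fst) hE
  have hint : Integrable (Function.uncurry fun t x ↦ E.indicator (fun _ ↦ h t * f x) (x - t))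
      (volume.prod ρ) := (hh.mul_prod hf).indicator hmeas
  calc ∫ t, h t * ∫ x in (· + t) '' E, f x ∂ρ
      = ∫ t, ∫ x, E.indicator (fun _ ↦ h t * f x) (x - t) ∂ρ := by
        refine integral_congr_ae (.of_forall fun t ↦ ?_)
        dsimp only
        rw [himage, ← integral_const_mul, ← integral_indicator (measurable_sub_const t hE)]
        rfl
    _ = ∫ x, (∫ t, E.indicator (fun _ ↦ h t * f x) (x - t)) ∂ρ := integral_integral_swap hint
    _ = ∫ x, (∫ u in E, f x * h (x - u)) ∂ρ := by
        refine integral_congr_ae (.of_forall fun x ↦ ?_)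
        dsimp only
        rw [← integral_sub_left_eq_self _ volume x, ← integral_indicator hE]
        refine integral_congr_ae (.of_forall fun u ↦ ?_)
        by_cases hu : u ∈ E <;> simp [hu, mul_comm]
    _ = ∫ u in E, ∫ x, f x * h (x - u) ∂ρ := by
        refine (integral_integral_swap ?_).symm
        have := (integrable_correlation_integrand hf hh).restrict (s := E ×ˢ Set.univ)
        rwa [← Measure.prod_restrict, Measure.restrict_univ] at this

end Correlation

theorem stmt16 (ρ : Measure ℝ) [IsFiniteMeasure ρ] (f : ℝ → ℂ) (hf : Integrable f ρ)
    (E : Set ℝ) (hE : MeasurableSet E)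
    (hmeas : Measurable (fun t : ℝ => ∫ x in (· + t) '' E, f x ∂ρ))
    (g : ℝ → ℂ) (hg : Integrable g)
    (χ : ℝ)
    (hχ : χ ∉ closure {s : ℝ | 𝓕 g s ≠ 0} +
      closure {s : ℝ |
        (∫ x, Complex.exp (((-(2 * Real.pi * s * x) : ℝ) : ℂ) * Complex.I) * f x ∂ρ) ≠ 0}) :
    ∫ t : ℝ, g t * (∫ x in (· + t) '' E, f x ∂ρ)
        * Complex.exp (((-(2 * Real.pi * χ * t) : ℝ) : ℂ) * Complex.I) = 0 := by
  simp_rw [exp_eq_fourierChar] at hχ ⊢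
  let h : ℝ → ℂ := fun t ↦ Real.fourierChar (-(χ * t)) * g t
  have hh : Integrable h := integrable_fourierChar_mul hg (by fun_prop)
  have hfourier (s : ℝ) : 𝓕 h (-s) = 𝓕 g (χ - s) := by
    have hadd (t : ℝ) : -((χ - s) * t) = -(-s * t) + -(χ * t) := by ring
    simp_rw [fourier_eq_integral_fourierChar_mul, h, hadd, AddChar.map_add_eq_mul,
      Circle.coe_mul, mul_assoc]
  have hzero : ∀ᵐ u, ∫ x, f x * h (x - u) ∂ρ = 0 := by
    refine ae_eq_zero_of_fourier_eq_zero
      (integrable_correlation_integrand hf hh).integral_prod_left fun s ↦ ?_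
    rw [fourier_correlation hf hh, hfourier]
    by_contra hne
    exact hχ ⟨χ - s, subset_closure (right_ne_zero_of_mul hne), s,
      subset_closure (left_ne_zero_of_mul hne), sub_add_cancel χ s⟩
  calc ∫ t, g t * (∫ x in (· + t) '' E, f x ∂ρ) * (Real.fourierChar (-(χ * t)) : ℂ)
      = ∫ t, h t * ∫ x in (· + t) '' E, f x ∂ρ :=
        integral_congr_ae (.of_forall fun t ↦ by simp only [h]; ring)
    _ = ∫ u in E, ∫ x, f x * h (x - u) ∂ρ := integral_mul_setIntegral_translate hf hh hE
    _ = 0 := integral_eq_zero_of_ae (ae_restrict_of_ae hzero)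
end
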